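/- Fix d > 0. There is a constant G depending only on J, K, ρ_max and d such that for all sufficiently large n there exists a deterministic prefix d-semifaithful code (φ_n, f_n, g_n) in the universal distortion setting satisfying, uniformly over all p ∈ P(A) and ρ ∈ D, (1/n)·E_p[ ln(2)· l(f_n(φ_n(X^n, ρ))) ] − E_p[R(T,d,ρ)] ≤ (2ρ_max ln n)/(d·n^{5/8}) + 4ρ_max(min(ln K, ln J) + ln 2)/(d·n^{5/8}) + ((K + 21/4)/2)·(ln n)/n + G·(ln ln n)/n + O(1/n), where the O(1/n) term depends only on J and K. -/

import Mathlib

open Filter MeasureTheory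
open scoped BigOperators

noncomputable section

variable {A B : Type*}

/-- `p` is a probability distribution on the finite alphabet `A`. -/
def IsProb [Fintype A] (p : A → ℝ) : Prop :=
  (∀ a, 0 ≤ p a) ∧ ∑ a, p a = 1

/-- `Q` is a conditional probability distribution from `A` to `B`. -/
def IsCondProb [Fintype A] [Fintype B] (Q : A → B → ℝ) : Prop :=
  ∀ j, IsProb (Q j)

/-- `ρ` is a distortion measure in the class `D`: bounded in `[0, ρmax]` and
with `max_j min_k ρ(j,k) = 0` (equivalently, every row contains a zero). -/
def IsDistMeasure [Fintype A] [Fintype B] (ρmax : ℝ) (ρ : A → B → ℝ) : Prop :=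
  (∀ j k, 0 ≤ ρ j k ∧ ρ j k ≤ ρmax) ∧ ∀ j, ∃ k, ρ j k = 0

/-- Mutual information `I(p, Q)` in nats. -/
def mutualInfo [Fintype A] [Fintype B] (p : A → ℝ) (Q : A → B → ℝ) : ℝ :=
  ∑ j, ∑ k, p j * Q j k * Real.log (Q j k / ∑ j', p j' * Q j' k)

/-- Average distortion `Σ_{j,k} p(j) Q(k|j) ρ(j,k)`. -/
def avgDist [Fintype A] [Fintype B] (p : A → ℝ) (Q : A → B → ℝ) (ρ : A → B → ℝ) : ℝ :=
  ∑ j, ∑ k, p j * Q j k * ρ j k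

/-- The rate-distortion function `R(p,d,ρ)` in nats. -/
def RD [Fintype A] [Fintype B] (p : A → ℝ) (d : ℝ) (ρ : A → B → ℝ) : ℝ :=
  sInf { r | ∃ Q, IsCondProb Q ∧ avgDist p Q ρ ≤ d ∧ r = mutualInfo p Q }

/-- The type (empirical distribution) of a sequence `x ∈ A^n`. -/
def typeOf [DecidableEq A] {n : ℕ} (x : Fin n → A) : A → ℝ :=
  fun a => ((Finset.univ.filter fun i => x i = a).card : ℝ) / n

/-- The i.i.d. product probability `p^n(x) = ∏ i p(x_i)`. -/
def prodProb {n : ℕ} (p : A → ℝ) (x : Fin n → A) : ℝ :=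
  ∏ i, p (x i)

/-- The `n`-fold single-letter distortion `ρ_n(x,y) = (1/n) Σ_i ρ(x_i, y_i)`. -/
def nDist {n : ℕ} (ρ : A → B → ℝ) (x : Fin n → A) (y : Fin n → B) : ℝ :=
  (∑ i, ρ (x i) (y i)) / n

/-- `E_p[R(T,d,ρ)]`, the expectation of the empirical rate-distortion function
over `X^n` i.i.d. `p` (written as a sum over sequences). -/
def expTypeRD [Fintype A] [DecidableEq A] [Fintype B] (n : ℕ) (p : A → ℝ)
    (d : ℝ) (ρ : A → B → ℝ) : ℝ :=
  ∑ x : Fin n → A, prodProb p x * RD (typeOf x) d ρ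


/-! ### Counting lemmas -/

def ct [DecidableEq A] {n : ℕ} (x : Fin n → A) (a : A) : ℕ :=
  (Finset.univ.filter fun i => x i = a).card

def jc [DecidableEq A] [DecidableEq B] {n : ℕ} (x : Fin n → A) (y : Fin n → B) (a : A) (b : B) : ℕ :=
  (Finset.univ.filter fun i => x i = a ∧ y i = b).card

lemma sum_ct [Fintype A] [DecidableEq A] {n : ℕ} (x : Fin n → A) : ∑ a, ct x a = n := by
  have := Finset.card_eq_sum_card_fiberwise (f := x) (s := Finset.univ) (t := Finset.univ)
    (by intro i _; simp)
  simp only [Finset.card_univ, Fintype.card_fin] at this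
  exact this.symm

lemma sum_comp_ct [Fintype A] [DecidableEq A] {n : ℕ} (x : Fin n → A) (h : A → ℝ) :
    ∑ i, h (x i) = ∑ a, (ct x a : ℝ) * h a := by
  rw [← Finset.sum_fiberwise Finset.univ x (fun i => h (x i))]
  refine Finset.sum_congr rfl fun a _ => ?_
  rw [Finset.sum_congr rfl (g := fun _ => h a)]
  · simp [ct]
  · intro i hi
    simp at hi
    simp [hi]

lemma prod_comp_ct [Fintype A] [DecidableEq A] {n : ℕ} (x : Fin n → A) (h : A → ℕ) :
    ∏ i, h (x i) = ∏ a, h a ^ ct x a := by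
  rw [← Finset.prod_fiberwise Finset.univ x (fun i => h (x i))]
  refine Finset.prod_congr rfl fun a _ => ?_
  rw [Finset.prod_congr rfl (g := fun _ => h a)]
  · simp [ct]
  · intro i hi
    simp at hi
    simp [hi]

lemma jc_eq_ct [DecidableEq A] [DecidableEq B] {n : ℕ} (x : Fin n → A) (y : Fin n → B) (a : A) (b : B) :
    jc x y a b = ct (fun i => (x i, y i)) (a, b) := by
  simp [jc, ct]

lemma sum_jc_left [Fintype B] [DecidableEq A] [DecidableEq B] {n : ℕ} (x : Fin n → A)
    (y : Fin n → B) (a : A) : ∑ b, jc x y a b = ct x a := by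
  have := Finset.card_eq_sum_card_fiberwise (f := y)
    (s := Finset.univ.filter fun i => x i = a) (t := Finset.univ) (by intro i _; simp)
  rw [ct, this]
  refine Finset.sum_congr rfl fun b _ => ?_
  rw [jc, Finset.filter_filter]

lemma sum_jc_right [Fintype A] [DecidableEq A] [DecidableEq B] {n : ℕ} (x : Fin n → A)
    (y : Fin n → B) (b : B) : ∑ a, jc x y a b = ct y b := by
  have := Finset.card_eq_sum_card_fiberwise (f := x)
    (s := Finset.univ.filter fun i => y i = b) (t := Finset.univ) (by intro i _; simp)
  rw [ct, this]
  refine Finset.sum_congr rfl fun a _ => ?_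
  rw [jc, Finset.filter_filter]
  simp only [and_comm]

lemma exists_jc [Fintype B] [DecidableEq A] [DecidableEq B] {n : ℕ} (x : Fin n → A)
    (N : A → B → ℕ) (h : ∀ a, ∑ b, N a b = ct x a) : ∃ y : Fin n → B, jc x y = N := by
  have e : ∀ a, Nonempty ({i // x i = a} ≃ (Σ b, Fin (N a b))) := by
    intro a
    refine ⟨Fintype.equivOfCardEq ?_⟩
    rw [Fintype.card_sigma, Fintype.card_subtype]
    simp [h, ct]
  replace e := fun a => Classical.choice (e a)
  refine ⟨fun i => (e (x i) ⟨i, rfl⟩).1, ?_⟩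
  funext a b
  have hh : jc x (fun i => (e (x i) ⟨i, rfl⟩).1) a b
      = (Finset.univ.filter fun j : {i // x i = a} => (e a j).1 = b).card := by
    unfold jc
    symm
    refine Finset.card_bij (fun j _ => j.1) ?_ ?_ ?_
    · rintro ⟨i, rfl⟩ hj
      simpa using hj
    · intro j _ j' _ hjj
      exact Subtype.ext hjj
    · intro i hi
      simp only [Finset.mem_filter, Finset.mem_univ, true_and] at hi
      obtain ⟨rfl, h2⟩ := hi
      exact ⟨⟨i, rfl⟩, by simpa using h2, rfl⟩
  rw [hh]
  have h2 : (Finset.univ.filter fun j : {i // x i = a} => (e a j).1 = b).card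
      = (Finset.univ.filter fun s : (Σ b, Fin (N a b)) => s.1 = b).card := by
    refine Finset.card_equiv (e a) ?_
    intro j
    simp
  rw [h2]
  have h3 : (Finset.univ.filter fun s : (Σ b, Fin (N a b)) => s.1 = b).card
      = (Finset.univ : Finset (Fin (N a b))).card := by
    symm
    refine Finset.card_bij (fun k _ => ⟨b, k⟩) ?_ ?_ ?_
    · simp
    · intro k _ k' _ hk
      simpa using hk
    · rintro ⟨b', k⟩ hs
      simp at hs
      subst hs
      exact ⟨k, by simp, rfl⟩
  rw [h3]; simp

lemma stab_card [Fintype A] [DecidableEq A] {n : ℕ} (x : Fin n → A) :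
    (Finset.univ.filter fun g : Equiv.Perm (Fin n) => x ∘ g = x).card
      = ∏ a, (ct x a).factorial := by
  have := DomMulAct.stabilizer_card x
  rw [Fintype.card_subtype] at this
  rw [this]
  refine Finset.prod_congr rfl fun a _ => ?_
  rw [Fintype.card_subtype]; rfl

lemma ct_comp_perm [DecidableEq A] {n : ℕ} (x : Fin n → A) (g : Equiv.Perm (Fin n)) (a : A) :
    ct (x ∘ g) a = ct x a := by
  unfold ct
  refine Finset.card_equiv g ?_
  intro i
  simp

lemma card_S [Fintype A] [DecidableEq A] [Fintype B] [DecidableEq B] {n : ℕ} (x : Fin n → A)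
    (y0 : Fin n → B) :
    ∏ a, (ct x a).factorial ≤
      (∏ a, ∏ b, (jc x y0 a b).factorial) *
        (Finset.univ.filter fun y : Fin n → B => jc x y = jc x y0).card := by
  rw [← stab_card]
  have hz : (∏ a, ∏ b, (jc x y0 a b).factorial) =
      (Finset.univ.filter fun g : Equiv.Perm (Fin n) =>
        (fun i => (x i, y0 i)) ∘ g = fun i => (x i, y0 i)).card := by
    rw [stab_card, Fintype.prod_prod_type]
    simp only [jc_eq_ct]
  rw [hz]
  refine Finset.card_le_mul_card_image_of_maps_to (f := fun g : Equiv.Perm (Fin n) => y0 ∘ g) ?_ _ ?_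
  · intro g hg
    simp only [Finset.coe_filter, Finset.mem_univ, true_and, Set.mem_ofPred_eq, Finset.mem_filter] at hg ⊢
    funext a b
    have : (fun i => (x i, (y0 ∘ g) i)) = (fun i => (x i, y0 i)) ∘ g := by
      funext i
      have := congrFun hg i
      simp only [Function.comp] at this ⊢
      rw [this]
    rw [jc_eq_ct, jc_eq_ct, this, ct_comp_perm]
  · intro y _
    rcases Finset.eq_empty_or_nonempty (Finset.filter (fun g : Equiv.Perm (Fin n) => y0 ∘ g = y)
      (Finset.univ.filter fun g : Equiv.Perm (Fin n) => x ∘ g = x)) with h | ⟨g0, h0⟩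
    · rw [h]; simp
    · simp only [Finset.mem_filter, Finset.mem_univ, true_and] at h0
      refine Finset.card_le_card_of_injOn (fun g => g * g0⁻¹) ?_ ?_
      · intro g hg
        simp only [Finset.coe_filter, Finset.mem_filter, Finset.mem_univ, true_and, Set.mem_ofPred_eq] at hg ⊢
        funext i
        have a1 := congrFun hg.1 (g0⁻¹ i)
        have a2 := congrFun h0.1 (g0⁻¹ i)
        have a3 := congrFun hg.2 (g0⁻¹ i)
        have a4 := congrFun h0.2 (g0⁻¹ i)
        simp at a1 a2 a3 a4 ⊢
        exact ⟨a1.trans a2.symm, a3.trans a4.symm⟩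
      · intro g _ g' _ hgg
        simpa using hgg

lemma card_Y [Fintype B] [DecidableEq B] {n : ℕ} (m : B → ℕ) (hm : ∑ b, m b = n) :
    (Finset.univ.filter fun y : Fin n → B => ∀ b, ct y b = m b).card * ∏ b, m b ^ m b ≤ n ^ n := by
  have h1 : ∑ y : Fin n → B, ∏ i, m (y i) = n ^ n := by
    have := (Finset.prod_univ_sum (fun _ : Fin n => (Finset.univ : Finset B)) (fun _ b => m b)).symm
    simpa [hm] using this
  rw [← h1, ← smul_eq_mul, ← Finset.sum_const]
  refine le_trans (Finset.sum_le_sum (g := fun y : Fin n → B => ∏ i, m (y i)) ?_)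
    (Finset.sum_le_sum_of_subset (Finset.subset_univ _))
  intro y hy
  simp only [Finset.mem_filter, Finset.mem_univ, true_and] at hy
  rw [prod_comp_ct]
  simp [hy]

/-! ### Covering lemma -/

lemma cover {X Y : Type*} [DecidableEq X] [DecidableEq Y] (S : Finset X) (T : Finset Y) (hT : T.Nonempty)
    (r : X → Y → Prop) [∀ x y, Decidable (r x y)] (δ : ℝ) (hδ1 : δ ≤ 1)
    (h : ∀ x ∈ S, δ * T.card ≤ ((T.filter fun y => r x y).card : ℝ)) (M : ℕ) :
    ∃ C : Finset Y, C.card ≤ M ∧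
      ((S.filter fun x => ∀ y ∈ C, ¬ r x y).card : ℝ) ≤ S.card * (1 - δ) ^ M := by
  induction M with
  | zero => exact ⟨∅, by simp, by simp⟩
  | succ M ih =>
    obtain ⟨C, hC, hU⟩ := ih
    set U := S.filter fun x => ∀ y ∈ C, ¬ r x y with hUdef
    have key : ∃ y ∈ T, δ * U.card ≤ ((U.filter fun x => r x y).card : ℝ) := by
      apply Finset.exists_le_of_sum_le hT
      have e1 : ∑ y ∈ T, ((U.filter fun x => r x y).card : ℝ)
          = ∑ x ∈ U, ((T.filter fun y => r x y).card : ℝ) := by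
        simp only [Finset.card_filter, Nat.cast_sum]
        exact Finset.sum_comm
      rw [e1]
      calc ∑ y ∈ T, δ * (U.card : ℝ) = ∑ x ∈ U, δ * T.card := by
            simp only [Finset.sum_const, nsmul_eq_mul]; ring
        _ ≤ _ := Finset.sum_le_sum fun x hx => h x (Finset.mem_filter.1 hx).1
    obtain ⟨y, hy, hyU⟩ := key
    refine ⟨insert y C, (Finset.card_insert_le _ _).trans (by omega), ?_⟩
    have e2 : (S.filter fun x => ∀ y' ∈ insert y C, ¬ r x y') = U.filter fun x => ¬ r x y := by
      rw [hUdef, Finset.filter_filter]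
      apply Finset.filter_congr
      intro x _
      simp [and_comm]
    rw [e2]
    have e3 := Finset.card_filter_add_card_filter_not (s := U) (fun x => r x y)
    have e4 : ((U.filter fun x => r x y).card : ℝ) + ((U.filter fun x => ¬ r x y).card : ℝ) = U.card := by
      exact_mod_cast e3
    calc ((U.filter fun x => ¬ r x y).card : ℝ) ≤ U.card * (1 - δ) := by linarith
      _ ≤ (S.card * (1 - δ) ^ M) * (1 - δ) := by
          apply mul_le_mul_of_nonneg_right hU; linarith
      _ = _ := by ring

/-! ### Prefix code -/

lemma exists_code_list (T : Type*) [Fintype T] (L : ℕ) (h : Fintype.card T ≤ 2 ^ L) :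
    ∃ e : T → List Bool, Function.Injective e ∧ ∀ t, (e t).length = L := by
  have : Nonempty (T ↪ (Fin L → Bool)) := by
    apply Function.Embedding.nonempty_of_card_le
    simpa using h
  obtain ⟨e⟩ := this
  refine ⟨fun t => List.ofFn (e t), ?_, by simp⟩
  intro a b hab
  exact e.injective (List.ofFn_injective hab)

lemma prefix_code {I Y : Type*} [Fintype I] [Nonempty I] [DecidableEq Y] (C : I → Finset Y) :
    ∃ f : Y → List Bool,
      (∀ i, ∀ y ∈ C i, (f y).length ≤ Nat.clog 2 (Fintype.card I) + Nat.clog 2 (C i).card) ∧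
      (∀ y y', (∃ i, y ∈ C i) → (∃ i, y' ∈ C i) → f y <+: f y' → y = y') := by
  classical
  obtain ⟨e, he, hel⟩ := exists_code_list I (Nat.clog 2 (Fintype.card I)) (Nat.le_pow_clog (by norm_num) _)
  have h2 : ∀ i, ∃ e : C i → List Bool, Function.Injective e ∧
      ∀ t, (e t).length = Nat.clog 2 (C i).card := fun i =>
    exists_code_list (C i) _ (by simpa using Nat.le_pow_clog (by norm_num) _)
  choose e2 he2 hel2 using h2
  have h3 : ∀ y, (∃ i, y ∈ C i) → ∃ i, y ∈ C i ∧ ∀ j, y ∈ C j → (C i).card ≤ (C j).card := by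
    rintro y ⟨i, hi⟩
    obtain ⟨j, hj, hmin⟩ := Finset.exists_min_image (Finset.univ.filter fun i => y ∈ C i)
      (fun i => (C i).card) ⟨i, by simpa using hi⟩
    refine ⟨j, by simpa using hj, fun k hk => hmin k (by simpa using hk)⟩
  choose! s hs hs2 using h3
  refine ⟨fun y => if h : y ∈ C (s y) then e (s y) ++ e2 (s y) ⟨y, h⟩ else [], ?_, ?_⟩
  · intro i y hy
    have := hs y ⟨i, hy⟩
    simp only [this, dif_pos, List.length_append, hel, hel2]
    exact Nat.add_le_add_left (Nat.clog_mono_right _ (hs2 y ⟨i, hy⟩ i hy)) _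
  · intro y y' hy hy' hp
    have a1 := hs y hy
    have a2 := hs y' hy'
    simp only [a1, a2, dif_pos] at hp
    have q : e (s y) = e (s y') := by
      have h1 : e (s y) <+: e (s y') ++ e2 (s y') ⟨y', a2⟩ := (List.prefix_append _ _).trans hp
      have h2 : e (s y') <+: e (s y') ++ e2 (s y') ⟨y', a2⟩ := List.prefix_append _ _
      exact (List.prefix_of_prefix_length_le h1 h2 (by simp [hel])).eq_of_length (by simp [hel])
    have q2 : s y = s y' := he q
    have gen : ∀ j (hj : s y = j) (hm : y' ∈ C j),
        (e (s y) ++ e2 (s y) ⟨y, a1⟩ <+: e j ++ e2 j ⟨y', hm⟩) → y = y' := by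
      rintro j rfl hm hpp
      have := hpp.eq_of_length (by simp [hel2])
      have := List.append_cancel_left this
      have := he2 _ this
      simpa using this
    exact gen _ q2 a2 hp

/-! ### Logarithmic estimates -/

/-- `u log u` -/
def eta (u : ℝ) : ℝ := u * Real.log u

lemma log_fact_lower (n : ℕ) : eta n - n ≤ Real.log (n.factorial : ℝ) := by
  rcases Nat.eq_zero_or_pos n with rfl | hn
  · simp [eta]
  have hn' : (0 : ℝ) < n := by exact_mod_cast hn
  have h := Real.pow_div_factorial_le_exp (n : ℝ) hn'.le n
  have hf : (0 : ℝ) < n.factorial := by exact_mod_cast n.factorial_pos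
  have h2 := Real.log_le_log (by positivity) h
  rw [Real.log_exp, Real.log_div (by positivity) hf.ne', Real.log_pow] at h2
  unfold eta
  linarith

lemma log_fact_upper (n : ℕ) : Real.log (n.factorial : ℝ) ≤ eta n - n + (Real.log n + 1) := by
  unfold eta
  induction n with
  | zero => simp
  | succ n ih =>
    rcases Nat.eq_zero_or_pos n with rfl | hn
    · simp
    have hn' : (0 : ℝ) < n := by exact_mod_cast hn
    have hf : (0 : ℝ) < n.factorial := by exact_mod_cast n.factorial_pos
    rw [Nat.factorial_succ]
    push_cast
    rw [Real.log_mul (by positivity) hf.ne']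
    have h1 : Real.log ((n : ℝ) / (n + 1)) ≤ (n : ℝ) / (n + 1) - 1 :=
      Real.log_le_sub_one_of_pos (by positivity)
    rw [Real.log_div (by positivity) (by positivity)] at h1
    have h2 : (n : ℝ) / (n + 1) - 1 = - (1 / (n + 1)) := by field_simp; ring
    rw [h2] at h1
    have h3 : ((n : ℝ) + 1) * (Real.log n - Real.log (n + 1)) ≤ -1 := by
      calc ((n : ℝ) + 1) * (Real.log n - Real.log (n + 1)) ≤ (n + 1) * (-(1 / (n + 1))) := by
            apply mul_le_mul_of_nonneg_left h1; positivity
        _ = -1 := by field_simp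
    nlinarith

lemma eta_mono_up {u v n : ℝ} (hv : 0 ≤ v) (huv : v ≤ u) (hun : u ≤ n) (hn : 1 ≤ n) :
    eta u - eta v ≤ (u - v) * (Real.log n + 1) := by
  unfold eta
  have hl : 0 ≤ Real.log n := Real.log_nonneg hn
  rcases hv.eq_or_lt with rfl | hv
  · rcases huv.eq_or_lt with rfl | hu
    · simp
    have := Real.log_le_log hu hun
    simp only [zero_mul, sub_zero]
    exact mul_le_mul_of_nonneg_left (by linarith) hu.le
  · have hu : 0 < u := lt_of_lt_of_le hv huv
    have h1 := Real.log_le_log hu hun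
    have h2 : Real.log (u / v) ≤ u / v - 1 := Real.log_le_sub_one_of_pos (by positivity)
    rw [Real.log_div hu.ne' hv.ne'] at h2
    have h3 : v * (Real.log u - Real.log v) ≤ u - v := by
      calc v * (Real.log u - Real.log v) ≤ v * (u / v - 1) := mul_le_mul_of_nonneg_left h2 hv.le
        _ = u - v := by field_simp
    have h4 : (u - v) * Real.log u ≤ (u - v) * Real.log n :=
      mul_le_mul_of_nonneg_left h1 (by linarith)
    nlinarith

lemma eta_mono_down {u v : ℝ} (hv : 0 ≤ v) (huv : v ≤ u) : eta v - eta u ≤ 1 := by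
  unfold eta
  have h0 : 0 ≤ u * Real.log u + 1 := by
    rcases (hv.trans huv).eq_or_lt with h | hu
    · simp [← h]
    have h2 := Real.one_sub_inv_le_log_of_pos hu
    have : u * (1 - u⁻¹) ≤ u * Real.log u := mul_le_mul_of_nonneg_left h2 hu.le
    have h3 : u * (1 - u⁻¹) = u - 1 := by field_simp
    linarith
  rcases le_total v 1 with h | h
  · have := Real.log_nonpos hv h
    nlinarith
  · have h1 := Real.log_le_log (by linarith) huv
    have h2 := Real.log_nonneg h
    have : v * Real.log v ≤ u * Real.log u := mul_le_mul huv h1 h2 (by linarith)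
    linarith

lemma eta_close {u v n c : ℝ} (hu : 0 ≤ u) (hv : 0 ≤ v) (hun : u ≤ n) (hn : 1 ≤ n)
    (hc : u - v ≤ c) (hc1 : 1 ≤ c) :
    eta u - eta v ≤ c * (Real.log n + 1) := by
  have hl : 0 ≤ Real.log n := Real.log_nonneg hn
  rcases le_total v u with h | h
  · refine (eta_mono_up hv h hun hn).trans ?_
    exact mul_le_mul_of_nonneg_right hc (by linarith)
  · refine (eta_mono_down hu h).trans ?_
    nlinarith

lemma clog_le {m : ℕ} (hm : 1 ≤ m) : Real.log 2 * (Nat.clog 2 m : ℝ) ≤ Real.log m + Real.log 2 := by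
  have hl : 0 < Real.log 2 := Real.log_pos (by norm_num)
  rcases hm.eq_or_lt with rfl | h
  · simp [hl.le]
  have h1 := Nat.pow_pred_clog_lt_self (b := 2) (by norm_num) h
  have h2 : 0 < Nat.clog 2 m := Nat.clog_pos (by norm_num) h
  have h3 : ((2 : ℝ) ^ (Nat.clog 2 m - 1)) ≤ m := by
    have := h1.le
    rw [Nat.pred_eq_sub_one] at this
    exact_mod_cast this
  have h4 := Real.log_le_log (by positivity) h3
  rw [Real.log_pow, Nat.cast_sub h2] at h4
  push_cast at h4
  linarith

/-! ### The type covering lemma -/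

/-- `n` times the mutual information of a joint count matrix. -/
def FI {J K : ℕ} (n : ℝ) (N : Fin J → Fin K → ℝ) : ℝ :=
  eta n - ∑ b, eta (∑ a, N a b) - ∑ a, eta (∑ b, N a b) + ∑ a, ∑ b, eta (N a b)

lemma log_prod_fact_lower {J : ℕ} (m : Fin J → ℕ) :
    ∑ a, (eta (m a) - m a) ≤ Real.log (∏ a, ((m a).factorial : ℝ)) := by
  rw [Real.log_prod (fun a _ => by exact_mod_cast (m a).factorial_ne_zero)]
  exact Finset.sum_le_sum fun a _ => log_fact_lower _

set_option maxHeartbeats 1000000 in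
lemma type_cover {J K : ℕ} (n : ℕ) (hn : 1 ≤ n) (N : Fin J → Fin K → ℕ) :
    ∃ C : Finset (Fin n → Fin K), ∀ x : Fin n → Fin J, (∀ a, ∑ b, N a b = ct x a) →
      (∃ y ∈ C, jc x y = N) ∧
      Real.log 2 * (Nat.clog 2 C.card : ℝ) ≤
        FI n (fun a b => (N a b : ℝ)) + J * K * (Real.log n + 1) + Real.log (n * (J + 1)) + Real.log 2 := by
  by_cases hx0 : ∃ x0 : Fin n → Fin J, ∀ a, ∑ b, N a b = ct x0 a
  swap
  · refine ⟨∅, fun x hx => absurd ⟨x, hx⟩ hx0⟩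
  obtain ⟨x0, hx0⟩ := hx0
  obtain ⟨y0, hy0⟩ := exists_jc x0 N hx0
  have hnR : (1 : ℝ) ≤ n := by exact_mod_cast hn
  set m : Fin K → ℕ := fun b => ∑ a, N a b with hm
  have hmy : ∀ b, ct y0 b = m b := by
    intro b; rw [hm, ← sum_jc_right x0, hy0]
  have hmn : ∑ b, m b = n := by rw [← sum_ct y0]; simp only [hmy]
  have hNn : ∀ a b, N a b ≤ n := by
    intro a b
    rw [← hmn]
    calc N a b ≤ m b := Finset.single_le_sum (f := fun a => N a b) (fun _ _ => Nat.zero_le _) (Finset.mem_univ a)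
      _ ≤ _ := Finset.single_le_sum (f := m) (fun _ _ => Nat.zero_le _) (Finset.mem_univ b)
  set r : Fin J → ℕ := fun a => ∑ b, N a b with hr
  have hrn : ∑ a, r a = n := by rw [← sum_ct x0]; simp only [hr, hx0]
  set T := (Finset.univ.filter fun y : Fin n → Fin K => ∀ b, ct y b = m b) with hT
  have hTne : T.Nonempty := ⟨y0, by simp [hT, hmy]⟩
  have hTpos : (0 : ℝ) < T.card := by exact_mod_cast hTne.card_pos
  -- real degree lower bound
  set PF : ℝ := ∏ a, ((r a).factorial : ℝ) with hPF
  set PG : ℝ := ∏ a, ∏ b, ((N a b).factorial : ℝ) with hPG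
  have hPFpos : 0 < PF := Finset.prod_pos fun a _ => by exact_mod_cast Nat.factorial_pos _
  have hPGpos : 0 < PG := Finset.prod_pos fun a _ => Finset.prod_pos fun b _ => by
    exact_mod_cast Nat.factorial_pos _
  set δ : ℝ := PF / PG / T.card with hδ
  have hδpos : 0 < δ := by positivity
  set S := (Finset.univ.filter fun x : Fin n → Fin J => ∀ a, r a = ct x a) with hS
  have hdeg : ∀ x ∈ S, δ * T.card ≤ ((T.filter fun y => jc x y = N).card : ℝ) := by
    intro x hx
    simp only [hS, Finset.mem_filter, Finset.mem_univ, true_and] at hx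
    obtain ⟨y, hy⟩ := exists_jc x N hx
    have h1 := card_S x y
    rw [hy] at h1
    have h2 : (T.filter fun y => jc x y = N) = Finset.univ.filter fun y => jc x y = N := by
      ext y'
      simp only [hT, Finset.mem_filter, Finset.mem_univ, true_and, and_iff_right_iff_imp]
      intro h b
      rw [← sum_jc_right x, h]
    rw [h2, hδ, div_mul_cancel₀ _ hTpos.ne', div_le_iff₀ hPGpos, mul_comm]
    have h3 : PF = ((∏ a, (ct x a).factorial : ℕ) : ℝ) := by
      rw [hPF]; push_cast; simp only [hx]
    have h4 : PG = ((∏ a, ∏ b, (N a b).factorial : ℕ) : ℝ) := by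
      rw [hPG]; push_cast; rfl
    rw [h3, h4]
    exact_mod_cast h1
  have hx0S : x0 ∈ S := by simp [hS, hr, hx0]
  have hδ1 : δ ≤ 1 := by
    have h1 := hdeg x0 hx0S
    have h2 : ((T.filter fun y => jc x0 y = N).card : ℝ) ≤ T.card := by
      exact_mod_cast Finset.card_filter_le _ _
    by_contra hcon
    push Not at hcon
    nlinarith
  -- number of codewords
  set M : ℕ := ⌊(n * J : ℝ) / δ⌋₊ + 1 with hM
  obtain ⟨C, hC, hCc⟩ := cover S T hTne (fun x y => jc x y = N) δ hδ1 hdeg M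
  have hJpos : (0 : ℝ) < J := by
    have : 0 < J := by
      rcases Nat.eq_zero_or_pos J with rfl | h
      · exact (x0 ⟨0, hn⟩).elim0
      · exact h
    exact_mod_cast this
  have hMδ : (n * J : ℝ) < M * δ := by
    have := Nat.lt_floor_add_one ((n * J : ℝ) / δ)
    rw [div_lt_iff₀ hδpos] at this
    rw [hM]; push_cast; exact this
  have hlt : (S.card : ℝ) * (1 - δ) ^ M < 1 := by
    have h1 : (S.card : ℝ) ≤ Real.exp (n * J) := by
      have : S.card ≤ J ^ n := by
        refine (Finset.card_le_univ _).trans ?_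
        simp
      calc (S.card : ℝ) ≤ (J : ℝ) ^ n := by exact_mod_cast this
        _ ≤ (Real.exp J) ^ n := by
            gcongr
            have := Real.add_one_le_exp (J : ℝ)
            linarith
        _ = _ := by rw [← Real.exp_nat_mul]
    have h2 : (1 - δ) ^ M ≤ Real.exp (-(M * δ)) := by
      calc (1 - δ) ^ M ≤ (Real.exp (-δ)) ^ M := by
            refine pow_le_pow_left₀ (by linarith) ?_ _
            have := Real.add_one_le_exp (-δ)
            linarith
        _ = _ := by rw [← Real.exp_nat_mul]; ring_nf
    calc (S.card : ℝ) * (1 - δ) ^ M ≤ Real.exp (n * J) * Real.exp (-(M * δ)) := by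
          apply mul_le_mul h1 h2 (pow_nonneg (by linarith) _) (Real.exp_pos _).le
      _ = Real.exp (n * J - M * δ) := by rw [← Real.exp_add]; ring_nf
      _ < 1 := by rw [Real.exp_lt_one_iff]; linarith
  have hempty : (S.filter fun x => ∀ y ∈ C, ¬ jc x y = N) = ∅ := by
    rw [← Finset.card_eq_zero]
    have h := lt_of_le_of_lt hCc hlt
    rw [Nat.cast_lt_one] at h
    convert h
  have hlogM : Real.log M ≤ - Real.log δ + Real.log (n * (J + 1)) := by
    have h1 : (M : ℝ) ≤ n * (J + 1) / δ := by
      have := Nat.floor_le (a := (n * J : ℝ) / δ) (by positivity)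
      have h2 : 1 ≤ (n : ℝ) / δ := by
        rw [le_div_iff₀ hδpos]; linarith
      calc (M : ℝ) ≤ (n * J : ℝ) / δ + 1 := by rw [hM]; push_cast; linarith
        _ ≤ (n * J : ℝ) / δ + n / δ := by linarith
        _ = _ := by ring
    have hMpos : (0 : ℝ) < M := by rw [hM]; positivity
    have h3 := Real.log_le_log hMpos h1
    rw [Real.log_div (by positivity) hδpos.ne'] at h3
    linarith
  have hlogδ : - Real.log δ ≤ FI n (fun a b => (N a b : ℝ)) + J * K * (Real.log n + 1) := by
    have e1 : Real.log δ = Real.log PF - Real.log PG - Real.log T.card := by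
      rw [hδ, Real.log_div (by positivity) hTpos.ne', Real.log_div hPFpos.ne' hPGpos.ne']
    have e2 : ∑ a, eta (r a) - n ≤ Real.log PF := by
      refine le_trans (le_of_eq ?_) (log_prod_fact_lower r)
      rw [Finset.sum_sub_distrib]
      congr 1
      exact_mod_cast hrn.symm
    have e3 : Real.log PG ≤ ∑ a, ∑ b, eta (N a b) - n + J * K * (Real.log n + 1) := by
      have : Real.log PG = ∑ a, ∑ b, Real.log ((N a b).factorial : ℝ) := by
        rw [hPG, Real.log_prod (fun a _ => ne_of_gt (Finset.prod_pos fun b _ => by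
          exact_mod_cast Nat.factorial_pos _))]
        refine Finset.sum_congr rfl fun a _ => ?_
        rw [Real.log_prod (fun b _ => by exact_mod_cast (N a b).factorial_ne_zero)]
      rw [this]
      have hb : ∀ a b, Real.log ((N a b).factorial : ℝ) ≤ eta (N a b) - N a b + (Real.log n + 1) := by
        intro a b
        refine (log_fact_upper _).trans ?_
        have : Real.log (N a b : ℝ) ≤ Real.log n := by
          rcases Nat.eq_zero_or_pos (N a b) with h | h
          · rw [h]; simp [Real.log_nonneg hnR]
          · exact Real.log_le_log (by exact_mod_cast h) (by exact_mod_cast hNn a b)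
        linarith
      refine (Finset.sum_le_sum fun a _ => Finset.sum_le_sum fun b _ => hb a b).trans ?_
      simp only [Finset.sum_add_distrib, Finset.sum_sub_distrib, Finset.sum_const, Finset.card_univ,
        Fintype.card_fin, nsmul_eq_mul]
      have : ∑ a, ∑ b, (N a b : ℝ) = n := by exact_mod_cast hrn
      rw [this]
      apply le_of_eq; ring
    have e4 : Real.log T.card ≤ eta n - ∑ b, eta (m b) := by
      have h1 : T.card * ∏ b, m b ^ m b ≤ n ^ n := by
        rw [hT]
        convert card_Y m hmn
      have h2 : (T.card : ℝ) * ∏ b, (m b : ℝ) ^ m b ≤ (n : ℝ) ^ n := by exact_mod_cast h1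
      have h3 : ∀ b, (0 : ℝ) < (m b : ℝ) ^ m b := by
        intro b
        rcases Nat.eq_zero_or_pos (m b) with h | h
        · rw [h]; simp
        · have : (0 : ℝ) < m b := by exact_mod_cast h
          positivity
      have h5 : 0 < ∏ b, (m b : ℝ) ^ m b := Finset.prod_pos fun b _ => h3 b
      have h4 := Real.log_le_log (by positivity) h2
      rw [Real.log_mul hTpos.ne' h5.ne', Real.log_prod (fun b _ => (h3 b).ne'), Real.log_pow] at h4
      simp only [Real.log_pow] at h4
      unfold eta
      linarith
    have e5 : FI n (fun a b => (N a b : ℝ)) =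
        eta n - ∑ b, eta (m b) - ∑ a, eta (r a) + ∑ a, ∑ b, eta (N a b) := by
      simp [FI, hm, hr]
    rw [e5, e1]
    linarith
  refine ⟨C, fun x hx => ⟨?_, ?_⟩⟩
  · by_contra hcon
    push Not at hcon
    have : x ∈ (S.filter fun x => ∀ y ∈ C, ¬ jc x y = N) := by
      simp only [hS, Finset.mem_filter, Finset.mem_univ, true_and]
      exact ⟨hx, hcon⟩
    rw [hempty] at this
    simp at this
  · have h1 : (Nat.clog 2 C.card : ℝ) ≤ Nat.clog 2 M := by exact_mod_cast Nat.clog_mono_right _ hC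
    have h2 : Real.log 2 * (Nat.clog 2 C.card : ℝ) ≤ Real.log 2 * Nat.clog 2 M :=
      mul_le_mul_of_nonneg_left h1 (Real.log_nonneg (by norm_num))
    have h3 := clog_le (m := M) (by omega)
    linarith

/-! ### Rounding a conditional distribution to a conditional type -/

lemma FI_eq {J K : ℕ} (n : ℕ) (hn : 1 ≤ n) (x : Fin n → Fin J) (Q : Fin J → Fin K → ℝ)
    (hQ : IsCondProb Q) :
    FI n (fun a b => (ct x a : ℝ) * Q a b) = n * mutualInfo (typeOf x) Q := by
  have hnpos : (0 : ℝ) < n := by exact_mod_cast hn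
  set u : Fin J → Fin K → ℝ := fun a b => (ct x a : ℝ) * Q a b with hu
  have hu0 : ∀ a b, 0 ≤ u a b := fun a b => mul_nonneg (Nat.cast_nonneg _) ((hQ a).1 b)
  have hrow : ∀ a, ∑ b, u a b = ct x a := by
    intro a
    rw [hu, ← Finset.mul_sum, (hQ a).2, mul_one]
  have htot : ∑ a, ∑ b, u a b = n := by
    simp only [hrow]
    exact_mod_cast sum_ct x
  have hterm : ∀ a b, (n : ℝ) * (typeOf x a * Q a b * Real.log (Q a b / ∑ j', typeOf x j' * Q j' b))
      = eta (u a b) - u a b * Real.log (ct x a) - u a b * Real.log (∑ a', u a' b)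
        + u a b * Real.log n := by
    intro a b
    have h1 : ∑ j', typeOf x j' * Q j' b = (∑ a', u a' b) / n := by
      rw [Finset.sum_div]
      refine Finset.sum_congr rfl fun j _ => ?_
      simp only [typeOf, hu, ct]; ring
    have h2 : (n : ℝ) * (typeOf x a * Q a b * Real.log (Q a b / ∑ j', typeOf x j' * Q j' b))
        = u a b * Real.log (Q a b / ((∑ a', u a' b) / n)) := by
      rw [h1]
      have : typeOf x a = (ct x a : ℝ) / n := rfl
      rw [this, hu]
      field_simp
    rw [h2]
    rcases (hu0 a b).eq_or_lt with h0 | hpos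
    · rw [← h0]; simp [eta]
    · have hc : (0 : ℝ) < ct x a := by
        rcases (Nat.cast_nonneg (ct x a) : (0 : ℝ) ≤ _).eq_or_lt with h | h
        · exfalso
          simp only [hu, ← h, zero_mul, lt_irrefl] at hpos
        · exact h
      have hq : 0 < Q a b := by
        by_contra hcon
        push Not at hcon
        have : u a b ≤ 0 := mul_nonpos_of_nonneg_of_nonpos hc.le hcon
        linarith
      have hv : 0 < ∑ a', u a' b := lt_of_lt_of_le hpos
        (Finset.single_le_sum (f := fun a' => u a' b) (fun a' _ => hu0 a' b) (Finset.mem_univ a))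
      rw [Real.log_div hq.ne' (by positivity), Real.log_div hv.ne' hnpos.ne']
      have : Real.log (u a b) = Real.log (ct x a) + Real.log (Q a b) := by
        rw [hu]; exact Real.log_mul hc.ne' hq.ne'
      unfold eta
      rw [this]
      ring
  unfold mutualInfo
  simp only [Finset.mul_sum, hterm]
  simp only [Finset.sum_add_distrib, Finset.sum_sub_distrib, ← Finset.sum_mul, hrow]
  rw [Finset.sum_comm (f := fun a b => u a b * Real.log (∑ a', u a' b))]
  simp only [← Finset.sum_mul]
  have htot2 : ∑ a, (ct x a : ℝ) = n := by exact_mod_cast sum_ct x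
  rw [htot2]
  unfold FI
  simp only [hrow, eta]
  ring

lemma rounding {J K : ℕ} (n : ℕ) (hn : 1 ≤ n) (hJ : 0 < J) (hK : 0 < K) (x : Fin n → Fin J)
    (ρmax d : ℝ) (ρ : Fin J → Fin K → ℝ) (hρ : IsDistMeasure ρmax ρ) (Q : Fin J → Fin K → ℝ)
    (hQ : IsCondProb Q) (hd : avgDist (typeOf x) Q ρ ≤ d) :
    ∃ N : Fin J → Fin K → ℕ, (∀ a, ∑ b, N a b = ct x a) ∧
      ∑ a, ∑ b, (N a b : ℝ) * ρ a b ≤ n * d ∧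
      FI n (fun a b => (N a b : ℝ)) ≤ n * mutualInfo (typeOf x) Q
        + (J * K * K + J * K) * (Real.log n + 1) := by
  have hnpos : (0 : ℝ) < n := by exact_mod_cast hn
  have hnR : (1 : ℝ) ≤ n := by exact_mod_cast hn
  have hJR : (1 : ℝ) ≤ J := by exact_mod_cast hJ
  have hKR : (1 : ℝ) ≤ K := by exact_mod_cast hK
  choose bs hbs using hρ.2
  set u : Fin J → Fin K → ℝ := fun a b => (ct x a : ℝ) * Q a b with hu
  have hu0 : ∀ a b, 0 ≤ u a b := fun a b => mul_nonneg (Nat.cast_nonneg _) ((hQ a).1 b)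
  have hrow : ∀ a, ∑ b, u a b = ct x a := by
    intro a
    rw [hu, ← Finset.mul_sum, (hQ a).2, mul_one]
  set w : Fin J → ℕ := fun a => ∑ b ∈ Finset.univ.erase (bs a), ⌊u a b⌋₊ with hw
  have hrow2 : ∀ a, ∑ b ∈ Finset.univ.erase (bs a), u a b + u a (bs a) = ct x a := by
    intro a
    rw [← hrow a, Finset.sum_erase_add _ _ (Finset.mem_univ _)]
  have hwle : ∀ a, (w a : ℝ) ≤ ∑ b ∈ Finset.univ.erase (bs a), u a b := by
    intro a
    rw [hw]; push_cast
    exact Finset.sum_le_sum fun b _ => Nat.floor_le (hu0 a b)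
  have hwge : ∀ a, ∑ b ∈ Finset.univ.erase (bs a), u a b ≤ w a + K := by
    intro a
    have : ∑ b ∈ Finset.univ.erase (bs a), u a b
        ≤ ∑ b ∈ Finset.univ.erase (bs a), ((⌊u a b⌋₊ : ℝ) + 1) :=
      Finset.sum_le_sum fun b _ => (Nat.lt_floor_add_one _).le
    refine this.trans ?_
    rw [Finset.sum_add_distrib, hw]
    push_cast
    gcongr
    simp only [Finset.sum_const, nsmul_eq_mul, mul_one]
    have : (Finset.univ.erase (bs a)).card ≤ K := by
      refine (Finset.card_le_univ _).trans (by simp)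
    exact_mod_cast this
  have hwc : ∀ a, w a ≤ ct x a := by
    intro a
    have h1 := hwle a
    have h2 := hrow2 a
    have h3 := hu0 a (bs a)
    have : (w a : ℝ) ≤ ct x a := by linarith
    exact_mod_cast this
  set N : Fin J → Fin K → ℕ := fun a b => if b = bs a then ct x a - w a else ⌊u a b⌋₊ with hN
  have hNs : ∀ a, (N a (bs a) : ℝ) = ct x a - w a := by
    intro a
    simp only [hN, if_true]
    rw [Nat.cast_sub (hwc a)]
  have hNo : ∀ a b, b ≠ bs a → N a b = ⌊u a b⌋₊ := by
    intro a b hb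
    simp only [hN, if_neg hb]
  have hNrow : ∀ a, ∑ b, N a b = ct x a := by
    intro a
    rw [← Finset.sum_erase_add _ _ (Finset.mem_univ (bs a))]
    have : ∑ b ∈ Finset.univ.erase (bs a), N a b = w a :=
      Finset.sum_congr rfl fun b hb => hNo a b (Finset.ne_of_mem_erase hb)
    rw [this]
    simp only [hN, if_true]
    have := hwc a
    omega
  have hup : ∀ a b, (N a b : ℝ) - u a b ≤ K := by
    intro a b
    by_cases hb : b = bs a
    · subst hb
      rw [hNs]
      have h1 := hwge a
      have h2 := hrow2 a
      linarith
    · rw [hNo a b hb]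
      have := Nat.floor_le (hu0 a b)
      linarith
  have hdown : ∀ a b, u a b - N a b ≤ 1 := by
    intro a b
    by_cases hb : b = bs a
    · subst hb
      rw [hNs]
      have h1 := hwle a
      have h2 := hrow2 a
      linarith
    · rw [hNo a b hb]
      have := (Nat.lt_floor_add_one (u a b)).le
      linarith
  have hctn : ∑ a, (ct x a : ℝ) = n := by exact_mod_cast sum_ct x
  refine ⟨N, hNrow, ?_, ?_⟩
  · have h1 : ∑ a, ∑ b, (N a b : ℝ) * ρ a b ≤ ∑ a, ∑ b, u a b * ρ a b := by
      refine Finset.sum_le_sum fun a _ => Finset.sum_le_sum fun b _ => ?_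
      by_cases hb : b = bs a
      · subst hb
        rw [hbs]; simp
      · rw [hNo a b hb]
        exact mul_le_mul_of_nonneg_right (Nat.floor_le (hu0 a b)) (hρ.1 a b).1
    have h2 : ∑ a, ∑ b, u a b * ρ a b = n * avgDist (typeOf x) Q ρ := by
      unfold avgDist
      simp only [Finset.mul_sum]
      refine Finset.sum_congr rfl fun a _ => Finset.sum_congr rfl fun b _ => ?_
      have : typeOf x a = (ct x a : ℝ) / n := rfl
      rw [this, hu]
      field_simp
    rw [h2] at h1
    exact h1.trans (mul_le_mul_of_nonneg_left hd hnpos.le)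
  · rw [← FI_eq n hn x Q hQ]
    have hNle : ∀ a b, (N a b : ℝ) ≤ n := by
      intro a b
      have h1 : N a b ≤ ct x a := by
        rw [← hNrow a]
        exact Finset.single_le_sum (f := fun b => N a b) (fun _ _ => Nat.zero_le _) (Finset.mem_univ b)
      have h2 : ct x a ≤ n := by
        conv_rhs => rw [← sum_ct x]
        exact Finset.single_le_sum (f := fun a => ct x a) (fun _ _ => Nat.zero_le _) (Finset.mem_univ a)
      exact_mod_cast h1.trans h2
    have hul : ∀ a b, u a b ≤ ct x a := by
      intro a b
      rw [← hrow a]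
      exact Finset.single_le_sum (f := fun b => u a b) (fun b _ => hu0 a b) (Finset.mem_univ b)
    have t1 : ∑ a, ∑ b, eta (N a b) - ∑ a, ∑ b, eta (u a b) ≤ J * K * K * (Real.log n + 1) := by
      rw [← Finset.sum_sub_distrib]
      simp only [← Finset.sum_sub_distrib]
      have : ∀ a b, eta (N a b) - eta (u a b) ≤ K * (Real.log n + 1) := fun a b =>
        eta_close (Nat.cast_nonneg _) (hu0 a b) (hNle a b) hnR (hup a b) hKR
      refine (Finset.sum_le_sum fun a _ => Finset.sum_le_sum fun b _ => this a b).trans ?_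
      simp only [Finset.sum_const, Finset.card_univ, Fintype.card_fin, nsmul_eq_mul]
      apply le_of_eq; ring
    have t2 : ∑ b, eta (∑ a, u a b) - ∑ b, eta (∑ a, (N a b : ℝ)) ≤ J * K * (Real.log n + 1) := by
      rw [← Finset.sum_sub_distrib]
      have : ∀ b, eta (∑ a, u a b) - eta (∑ a, (N a b : ℝ)) ≤ J * (Real.log n + 1) := by
        intro b
        refine eta_close (Finset.sum_nonneg fun a _ => hu0 a b)
          (Finset.sum_nonneg fun a _ => Nat.cast_nonneg _) ?_ hnR ?_ hJR
        · rw [← hctn]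
          exact Finset.sum_le_sum fun a _ => hul a b
        · rw [← Finset.sum_sub_distrib]
          refine (Finset.sum_le_sum fun a _ => hdown a b).trans ?_
          simp
      refine (Finset.sum_le_sum fun b _ => this b).trans ?_
      simp only [Finset.sum_const, Finset.card_univ, Fintype.card_fin, nsmul_eq_mul]
      apply le_of_eq; ring
    have t3 : ∀ a, ∑ b, (N a b : ℝ) = ct x a := fun a => by exact_mod_cast hNrow a
    have hu' : (fun a b => (ct x a : ℝ) * Q a b) = u := rfl
    rw [hu']
    unfold FI
    simp only [t3, hrow]
    linarith

/-! ### Assembling the code -/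

lemma sum_rho {J K : ℕ} {n : ℕ} (x : Fin n → Fin J) (y : Fin n → Fin K) (ρ : Fin J → Fin K → ℝ) :
    ∑ i, ρ (x i) (y i) = ∑ a, ∑ b, (jc x y a b : ℝ) * ρ a b := by
  have := sum_comp_ct (fun i => (x i, y i)) (fun p : Fin J × Fin K => ρ p.1 p.2)
  simp only at this
  rw [this, Fintype.sum_prod_type]
  simp only [jc_eq_ct]

lemma pointwise_code (J K : ℕ) (hJ : 0 < J) (hK : 0 < K) (ρmax d : ℝ) (hd : 0 < d)
    (n : ℕ) (hn : 1 ≤ n) :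
    ∃ (φ : (Fin n → Fin J) → (Fin J → Fin K → ℝ) → (Fin n → Fin K))
        (f : (Fin n → Fin K) → List Bool)
        (g : List Bool → (Fin n → Fin K)),
        (∀ x ρ, IsDistMeasure ρmax ρ → nDist ρ x (φ x ρ) ≤ d) ∧
        (∀ x ρ, IsDistMeasure ρmax ρ → g (f (φ x ρ)) = φ x ρ) ∧
        (∀ x₁ ρ₁ x₂ ρ₂, IsDistMeasure ρmax ρ₁ → IsDistMeasure ρmax ρ₂ →
          f (φ x₁ ρ₁) <+: f (φ x₂ ρ₂) → f (φ x₁ ρ₁) = f (φ x₂ ρ₂)) ∧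
        (∀ x ρ, IsDistMeasure ρmax ρ → Real.log 2 * ((f (φ x ρ)).length : ℝ) ≤
          n * RD (typeOf x) d ρ + (Real.log ((n + 1 : ℝ) ^ (J * K)) + Real.log 2
            + (J * K * K + J * K) * (Real.log n + 1) + J * K * (Real.log n + 1)
            + Real.log (n * (J + 1)) + Real.log 2)) := by
  classical
  have hnpos : (0 : ℝ) < n := by exact_mod_cast hn
  choose C hC using fun N : Fin J → Fin K → Fin (n + 1) =>
    type_cover (J := J) (K := K) n hn (fun a b => (N a b : ℕ))
  obtain ⟨f, hf1, hf2⟩ := prefix_code C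
  set Good : (Fin n → Fin J) → (Fin J → Fin K → ℝ) → Finset (Fin n → Fin K) := fun x ρ =>
    Finset.univ.filter fun y => (∃ N, y ∈ C N) ∧ nDist ρ x y ≤ d with hGood
  set c0 : ℝ := (Real.log ((n + 1 : ℝ) ^ (J * K)) + Real.log 2
            + (J * K * K + J * K) * (Real.log n + 1) + J * K * (Real.log n + 1)
            + Real.log (n * (J + 1)) + Real.log 2) with hc0
  have key : ∀ x ρ, IsDistMeasure ρmax ρ → ∀ Q, IsCondProb Q → avgDist (typeOf x) Q ρ ≤ d →
      ∃ y ∈ Good x ρ, Real.log 2 * ((f y).length : ℝ) ≤ n * mutualInfo (typeOf x) Q + c0 := by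
    intro x ρ hρ Q hQ hQd
    obtain ⟨N, hN1, hN2, hN3⟩ := rounding n hn hJ hK x ρmax d ρ hρ Q hQ hQd
    have hNle : ∀ a b, N a b < n + 1 := by
      intro a b
      have h1 : N a b ≤ ct x a := by
        rw [← hN1 a]
        exact Finset.single_le_sum (f := fun b => N a b) (fun _ _ => Nat.zero_le _) (Finset.mem_univ b)
      have h2 : ct x a ≤ n := by
        conv_rhs => rw [← sum_ct x]
        exact Finset.single_le_sum (f := fun a => ct x a) (fun _ _ => Nat.zero_le _) (Finset.mem_univ a)
      omega
    obtain ⟨⟨y, hyC, hyN⟩, hlen⟩ := hC (fun a b => ⟨N a b, hNle a b⟩) x hN1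
    refine ⟨y, ?_, ?_⟩
    · simp only [hGood, Finset.mem_filter, Finset.mem_univ, true_and]
      refine ⟨⟨_, hyC⟩, ?_⟩
      unfold nDist
      rw [sum_rho, hyN, div_le_iff₀ hnpos, mul_comm d]
      exact hN2
    · have h1 := hf1 _ y hyC
      set cc := (C fun a b => ⟨N a b, hNle a b⟩).card
      have h2 : ((f y).length : ℝ) ≤
          (Nat.clog 2 (Fintype.card (Fin J → Fin K → Fin (n + 1))) : ℝ) + (Nat.clog 2 cc : ℝ) := by
        exact_mod_cast h1
      have hcard : Fintype.card (Fin J → Fin K → Fin (n + 1)) = (n + 1) ^ (J * K) := by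
        simp only [Fintype.card_pi, Fintype.card_fin, Finset.prod_const, Finset.card_univ]
        rw [← pow_mul, mul_comm]
      rw [hcard] at h2
      have h3 := clog_le (m := (n + 1) ^ (J * K)) (Nat.one_le_pow _ _ (by omega))
      have h4 := mul_le_mul_of_nonneg_left h2 (Real.log_nonneg (by norm_num : (1 : ℝ) ≤ 2))
      push_cast at h3
      simp only at hlen
      rw [mul_add] at h4
      linarith
  have hex : ∀ x : Fin n → Fin J, ∀ ρ : Fin J → Fin K → ℝ, IsDistMeasure ρmax ρ →
      ∃ Q : Fin J → Fin K → ℝ, IsCondProb Q ∧ avgDist (typeOf x) Q ρ ≤ d := by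
    intro x ρ hρ
    choose bs hbs using hρ.2
    refine ⟨fun a b => if b = bs a then 1 else 0, fun a => ⟨fun b => ?_, by simp⟩, ?_⟩
    · dsimp only
      split_ifs <;> norm_num
    · unfold avgDist
      simp [hbs, hd.le]
  have hsel : ∀ x ρ, ∃ y : Fin n → Fin K, IsDistMeasure ρmax ρ → y ∈ Good x ρ ∧
      ∀ y' ∈ Good x ρ, (f y).length ≤ (f y').length := by
    intro x ρ
    by_cases hρ : IsDistMeasure ρmax ρ
    · obtain ⟨Q, hQ, hQd⟩ := hex x ρ hρ
      obtain ⟨y, hy, _⟩ := key x ρ hρ Q hQ hQd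
      obtain ⟨y1, h1, h2⟩ := Finset.exists_min_image (Good x ρ) (fun y => (f y).length) ⟨y, hy⟩
      exact ⟨y1, fun _ => ⟨h1, h2⟩⟩
    · exact ⟨fun _ => ⟨0, hK⟩, fun h => absurd h hρ⟩
  choose φ hφ using hsel
  have hφC : ∀ x ρ, IsDistMeasure ρmax ρ → (∃ N, φ x ρ ∈ C N) ∧ nDist ρ x (φ x ρ) ≤ d := by
    intro x ρ hρ
    have := (hφ x ρ hρ).1
    simpa only [hGood, Finset.mem_filter, Finset.mem_univ, true_and] using this
  haveI : Nonempty (Fin n → Fin K) := ⟨fun _ => ⟨0, hK⟩⟩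
  refine ⟨φ, f, Function.invFunOn f {y | ∃ N, y ∈ C N}, ?_, ?_, ?_, ?_⟩
  · intro x ρ hρ
    exact (hφC x ρ hρ).2
  · intro x ρ hρ
    have hinj : Set.InjOn f {y | ∃ N, y ∈ C N} := by
      intro y hy y' hy' h
      exact hf2 y y' hy hy' (h ▸ List.prefix_refl _)
    exact hinj.leftInvOn_invFunOn (hφC x ρ hρ).1
  · intro x₁ ρ₁ x₂ ρ₂ h1 h2 hp
    rw [hf2 _ _ (hφC x₁ ρ₁ h1).1 (hφC x₂ ρ₂ h2).1 hp]
  · intro x ρ hρ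
    have : (Real.log 2 * ((f (φ x ρ)).length : ℝ) - c0) / n ≤ RD (typeOf x) d ρ := by
      unfold RD
      refine le_csInf ?_ ?_
      · obtain ⟨Q, hQ, hQd⟩ := hex x ρ hρ
        exact ⟨_, Q, hQ, hQd, rfl⟩
      · rintro r ⟨Q, hQ, hQd, rfl⟩
        obtain ⟨y, hy, hyl⟩ := key x ρ hρ Q hQ hQd
        have h1 := (hφ x ρ hρ).2 y hy
        have h2 : ((f (φ x ρ)).length : ℝ) ≤ (f y).length := by exact_mod_cast h1
        have h3 := mul_le_mul_of_nonneg_left h2 (Real.log_nonneg (by norm_num : (1 : ℝ) ≤ 2))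
        rw [div_le_iff₀ hnpos]
        linarith
    rw [div_le_iff₀ hnpos] at this
    linarith

lemma sum_prodProb {J : ℕ} (n : ℕ) (p : Fin J → ℝ) (hp : IsProb p) :
    ∑ x : Fin n → Fin J, prodProb p x = 1 := by
  unfold prodProb
  rw [← Fintype.sum_pow, hp.2, one_pow]

lemma prodProb_nonneg {J : ℕ} {n : ℕ} (p : Fin J → ℝ) (hp : IsProb p) (x : Fin n → Fin J) :
    0 ≤ prodProb p x := Finset.prod_nonneg fun i _ => hp.1 _

/-- The accumulated overhead is `O(log n)`. -/
lemma overhead_bound (J K : ℕ) : ∃ C0 : ℝ, 0 < C0 ∧ ∀ n : ℕ, 3 ≤ n →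
    Real.log ((n + 1 : ℝ) ^ (J * K)) + Real.log 2
            + (J * K * K + J * K) * (Real.log n + 1) + J * K * (Real.log n + 1)
            + Real.log (n * (J + 1)) + Real.log 2 ≤ C0 * Real.log n := by
  refine ⟨2 * (J * K) + 1 + (J * K * K + J * K) * 2 + J * K * 2 + (1 + Real.log (J + 1)) + 1, ?_, ?_⟩
  · have : 0 ≤ Real.log ((J : ℝ) + 1) := Real.log_nonneg (by linarith [(Nat.cast_nonneg J : (0 : ℝ) ≤ J)])
    positivity
  · intro n hn
    have hnR : (3 : ℝ) ≤ n := by exact_mod_cast hn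
    have hl1 : 1 ≤ Real.log n := by
      rw [Real.le_log_iff_exp_le (by linarith)]
      have := Real.exp_one_lt_d9
      linarith
    have hJ0 : 0 ≤ Real.log ((J : ℝ) + 1) := Real.log_nonneg (by linarith [(Nat.cast_nonneg J : (0 : ℝ) ≤ J)])
    have h2 : Real.log 2 ≤ Real.log n := Real.log_le_log (by norm_num) (by linarith)
    have h3 : Real.log ((n : ℝ) + 1) ≤ 2 * Real.log n := by
      have : Real.log ((n : ℝ) + 1) ≤ Real.log ((n : ℝ) ^ 2) :=
        Real.log_le_log (by linarith) (by nlinarith)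
      rw [Real.log_pow] at this
      exact_mod_cast this
    rw [Real.log_pow, Real.log_mul (by linarith) (by positivity)]
    push_cast
    have a1 : ((J : ℝ) * K) * Real.log ((n : ℝ) + 1) ≤ (J * K) * (2 * Real.log n) :=
      mul_le_mul_of_nonneg_left h3 (by positivity)
    have a2 : ((J : ℝ) * K * K + J * K) * (Real.log n + 1) ≤ (J * K * K + J * K) * (2 * Real.log n) :=
      mul_le_mul_of_nonneg_left (by linarith) (by positivity)
    have a3 : ((J : ℝ) * K) * (Real.log n + 1) ≤ (J * K) * (2 * Real.log n) :=
      mul_le_mul_of_nonneg_left (by linarith) (by positivity)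
    have a4 : Real.log ((J : ℝ) + 1) ≤ Real.log (J + 1) * Real.log n := by nlinarith
    nlinarith

/-- Theorem 4: there is a constant `c` depending only on `J` and `K`
(the `O(1/n)` term) such that for every `ρmax > 0` and `d > 0` there is a constant `G`
(depending only on `J, K, ρmax, d`) such that for sufficiently large `n` there is a
*deterministic prefix* `d`-semifaithful code in the universal distortion setting whose
expected rate exceeds `E_p[R(T,d,ρ)]` by at most the stated bound, uniformly over all
sources `p` and distortion measures `ρ ∈ D`. -/
theorem deterministic_prefix_universal_code (J K : ℕ) (hJ : 0 < J) (hK : 0 < K) :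
    ∃ c : ℝ, ∀ ρmax d : ℝ, 0 < ρmax → 0 < d →
    ∃ G : ℝ, ∃ N : ℕ, ∀ n : ℕ, N ≤ n →
      ∃ (φ : (Fin n → Fin J) → (Fin J → Fin K → ℝ) → (Fin n → Fin K))
        (f : (Fin n → Fin K) → List Bool)
        (g : List Bool → (Fin n → Fin K)),
        -- d-semifaithful for every sequence and every ρ ∈ D
        (∀ x ρ, IsDistMeasure ρmax ρ → nDist ρ x (φ x ρ) ≤ d) ∧
        -- lossless binary encoder/decoder pair on the codebook
        (∀ x ρ, IsDistMeasure ρmax ρ → g (f (φ x ρ)) = φ x ρ) ∧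
        -- prefix condition on the codebook
        (∀ x₁ ρ₁ x₂ ρ₂, IsDistMeasure ρmax ρ₁ → IsDistMeasure ρmax ρ₂ →
          f (φ x₁ ρ₁) <+: f (φ x₂ ρ₂) → f (φ x₁ ρ₁) = f (φ x₂ ρ₂)) ∧
        -- uniform expected-rate bound
        (∀ (p : Fin J → ℝ), IsProb p → ∀ ρ : Fin J → Fin K → ℝ, IsDistMeasure ρmax ρ →
          (1 / (n : ℝ)) * (∑ x : Fin n → Fin J, prodProb p x *
              (Real.log 2 * ((f (φ x ρ)).length : ℝ)))
            - expTypeRD n p d ρ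
          ≤ 2 * ρmax * Real.log n / (d * (n : ℝ) ^ ((5 : ℝ) / 8))
            + 4 * ρmax * (min (Real.log K) (Real.log J) + Real.log 2)
                / (d * (n : ℝ) ^ ((5 : ℝ) / 8))
            + (((K : ℝ) + 21 / 4) / 2) * (Real.log n / n)
            + G * (Real.log (Real.log n) / n)
            + c / n) := by

  obtain ⟨C0, hC0, hover⟩ := overhead_bound J K
  refine ⟨0, fun ρmax d hρmax hd => ⟨0, ?_⟩⟩
  have htend : Tendsto (fun n : ℕ => (n : ℝ) ^ ((3 : ℝ) / 8)) atTop atTop :=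
    (tendsto_rpow_atTop (by norm_num)).comp tendsto_natCast_atTop_atTop
  obtain ⟨N, hN⟩ := Filter.eventually_atTop.1 (htend.eventually_ge_atTop (C0 * d / (2 * ρmax)))
  refine ⟨max N 3, fun n hn => ?_⟩
  have hn3 : 3 ≤ n := (le_max_right _ _).trans hn
  have hnN := hN n ((le_max_left _ _).trans hn)
  obtain ⟨φ, f, g, h1, h2, h3, h4⟩ := pointwise_code J K hJ hK ρmax d hd n (by omega)
  refine ⟨φ, f, g, h1, h2, h3, fun p hp ρ hρ => ?_⟩
  have hnR : (3 : ℝ) ≤ n := by exact_mod_cast hn3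
  have hnpos : (0 : ℝ) < n := by linarith
  have hlog : 0 ≤ Real.log n := Real.log_nonneg (by linarith)
  have hsum : (∑ x : Fin n → Fin J, prodProb p x * (Real.log 2 * ((f (φ x ρ)).length : ℝ)))
      ≤ n * expTypeRD n p d ρ + C0 * Real.log n := by
    calc (∑ x : Fin n → Fin J, prodProb p x * (Real.log 2 * ((f (φ x ρ)).length : ℝ)))
        ≤ ∑ x : Fin n → Fin J, prodProb p x * (n * RD (typeOf x) d ρ + C0 * Real.log n) := by
          refine Finset.sum_le_sum fun x _ => ?_
          refine mul_le_mul_of_nonneg_left ?_ (prodProb_nonneg p hp x)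
          have := h4 x ρ hρ
          have := hover n hn3
          linarith
      _ = n * expTypeRD n p d ρ + C0 * Real.log n := by
          unfold expTypeRD
          simp only [mul_add, Finset.sum_add_distrib, ← Finset.sum_mul, sum_prodProb n p hp, one_mul]
          congr 1
          rw [Finset.mul_sum]
          refine Finset.sum_congr rfl fun x _ => ?_
          ring
  have hmain : (1 / (n : ℝ)) * (∑ x : Fin n → Fin J, prodProb p x *
              (Real.log 2 * ((f (φ x ρ)).length : ℝ))) - expTypeRD n p d ρ ≤ C0 * Real.log n / n := by
    rw [one_div, inv_mul_eq_div, sub_le_iff_le_add, div_le_iff₀ hnpos, add_mul,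
      div_mul_cancel₀ _ hnpos.ne']
    linarith
  have hpow : (n : ℝ) = (n : ℝ) ^ ((3 : ℝ) / 8) * (n : ℝ) ^ ((5 : ℝ) / 8) := by
    rw [← Real.rpow_add hnpos]; norm_num
  have hp5 : 0 < (n : ℝ) ^ ((5 : ℝ) / 8) := Real.rpow_pos_of_pos hnpos _
  have hfirst : C0 * Real.log n / n ≤ 2 * ρmax * Real.log n / (d * (n : ℝ) ^ ((5 : ℝ) / 8)) := by
    rw [div_le_div_iff₀ hnpos (by positivity)]
    rw [div_le_iff₀ (by positivity)] at hnN
    calc C0 * Real.log n * (d * (n : ℝ) ^ ((5 : ℝ) / 8))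
        = (C0 * d) * (Real.log n * (n : ℝ) ^ ((5 : ℝ) / 8)) := by ring
      _ ≤ ((n : ℝ) ^ ((3 : ℝ) / 8) * (2 * ρmax)) * (Real.log n * (n : ℝ) ^ ((5 : ℝ) / 8)) :=
          mul_le_mul_of_nonneg_right hnN (by positivity)
      _ = 2 * ρmax * Real.log n * ((n : ℝ) ^ ((3 : ℝ) / 8) * (n : ℝ) ^ ((5 : ℝ) / 8)) := by ring
      _ = 2 * ρmax * Real.log n * n := by rw [← hpow]
  have hmin : 0 ≤ min (Real.log K) (Real.log J) :=
    le_min (Real.log_natCast_nonneg _) (Real.log_natCast_nonneg _)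
  have hl2 : 0 ≤ Real.log 2 := Real.log_nonneg (by norm_num)
  have hsec : 0 ≤ 4 * ρmax * (min (Real.log K) (Real.log J) + Real.log 2)
                / (d * (n : ℝ) ^ ((5 : ℝ) / 8)) := by positivity
  have hthird : 0 ≤ (((K : ℝ) + 21 / 4) / 2) * (Real.log n / n) := by positivity
  rw [zero_mul, zero_div]
  linarith
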